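/- Let T be an n,k-complete perfect phylogeny tree that generates a frequency tensor F. If (c,i) ≺_T (d,j) with (c,i) ≠ (d,j), then there exists a valid descendant set pair (D_{(c,i)}, D_{(d,j)}). -/

import Mathlib

open Finset
open scoped Classical

/-- Vertices of an `n,k`-complete perfect phylogeny tree: `none` is the root
`v_{(*,0)}`, and `some (c, i)` with `i ≠ 0` is the vertex `v_{(c,i)}`. -/
abbrev PPVert (n k : ℕ) [NeZero k] : Type :=
  Option (Fin n × {i : Fin k // i ≠ 0})

/-- An `n,k`-complete perfect phylogeny tree: each of the `n(k-1)` non-root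
vertices `v_{(c,i)}` is the head of the unique edge labeled `(c,i)` and has a
parent vertex; a depth function witnesses acyclicity (so the parent map
generates a tree rooted at the root `none`). -/
structure CPPTree (n k : ℕ) [NeZero k] where
  parent : Fin n → {i : Fin k // i ≠ 0} → PPVert n k
  depth : PPVert n k → ℕ
  depth_lt : ∀ c i, depth (parent c i) < depth (some (c, i))

variable {m n k : ℕ} [NeZero k]

/-- The vertex `v_{(c,i)}`; for `i = 0` this is the root `v_{(*,0)}`. -/
def vtx (c : Fin n) (i : Fin k) : PPVert n k :=
  if h : i = 0 then none else some (c, ⟨i, h⟩)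

namespace CPPTree

/-- `childRel T u v` holds when `u` is the parent of `v` in `T`. -/
def childRel (T : CPPTree n k) (u v : PPVert n k) : Prop :=
  ∃ c i, v = some (c, i) ∧ T.parent c i = u

/-- The (reflexive) ancestor relation `≺_T` on the vertices of `T`. -/
def anc (T : CPPTree n k) : PPVert n k → PPVert n k → Prop :=
  Relation.ReflTransGen T.childRel

/-- The descendant set `D_{(c,i)} = { j | (c,i) ≺_T (c,j) }`. -/
noncomputable def D (T : CPPTree n k) (c : Fin n) (i : Fin k) : Finset (Fin k) :=
  Finset.univ.filter fun j => T.anc (vtx c i) (vtx c j)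

/-- The labels of the children of a vertex `v` of `T`. -/
noncomputable def childrenOf (T : CPPTree n k) (v : PPVert n k) :
    Finset (Fin n × {i : Fin k // i ≠ 0}) :=
  Finset.univ.filter fun dj => T.parent dj.1 dj.2 = v

/-- `δ(c,i)`: the labels of the children of the vertex `v_{(c,i)}`. -/
noncomputable def children (T : CPPTree n k) (c : Fin n) (i : Fin k) :
    Finset (Fin n × {i : Fin k // i ≠ 0}) :=
  T.childrenOf (vtx c i)

end CPPTree

/-- `f` is a `k × m × n` frequency tensor. -/
def IsFreqTensor (f : Fin m → Fin n → Fin k → ℝ) : Prop :=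
  (∀ p c i, 0 ≤ f p c i) ∧ ∀ p c, ∑ i, f p c i = 1

/-- The cumulative frequency `f⁺_p(D)` of `D` for character `c` in sample `p`. -/
noncomputable def fplus (f : Fin m → Fin n → Fin k → ℝ) (p : Fin m) (c : Fin n)
    (D : Finset (Fin k)) : ℝ :=
  ∑ l ∈ D, f p c l

/-- The usage `u_{p,(c,i)} = f⁺_p(D_{(c,i)}) − Σ_{(d,j)∈δ(c,i)} f⁺_p(D_{(d,j)})`
of a vertex in sample `p`; for the root, `f⁺_p(D_{(*,0)}) = 1`. -/
noncomputable def usage (T : CPPTree n k) (f : Fin m → Fin n → Fin k → ℝ)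
    (p : Fin m) : PPVert n k → ℝ
  | none => 1 - ∑ dj ∈ T.childrenOf none, fplus f p dj.1 (T.D dj.1 dj.2.1)
  | some (c, i) =>
      fplus f p c (T.D c i.1) - ∑ dj ∈ T.children c i.1, fplus f p dj.1 (T.D dj.1 dj.2.1)

/-- `v ∈ T_{(c,i)}`: the state vector of `v` has state `i` for character `c`,
i.e. `v_{(c,i)}` is the lowest ancestor of `v` among the vertices `v_{(c,j)}`. -/
def CPPTree.hasState (T : CPPTree n k) (v : PPVert n k) (c : Fin n) (i : Fin k) : Prop :=
  T.anc (vtx c i) v ∧ ∀ j : Fin k, T.anc (vtx c j) v → T.anc (vtx c j) (vtx c i)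

/-- `T_{(c,i)}`: the set of vertices whose state vector has state `i` at `c`. -/
noncomputable def CPPTree.stateSet (T : CPPTree n k) (c : Fin n) (i : Fin k) :
    Finset (PPVert n k) :=
  Finset.univ.filter fun v => T.hasState v c i


/-- `T` generates `F`: the matrix `U` defined by
`u_{p,(c,i)} = f⁺_p(D_{(c,i)}) − Σ_{(d,j)∈δ(c,i)} f⁺_p(D_{(d,j)})` is an
`m,n,k`-usage matrix, i.e. has nonnegative entries and rows summing to 1. -/
def Generates (T : CPPTree n k) (f : Fin m → Fin n → Fin k → ℝ) : Prop :=
  (∀ (p : Fin m) (v : PPVert n k), 0 ≤ usage T f p v) ∧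
    ∀ p : Fin m, ∑ v : PPVert n k, usage T f p v = 1

/-- `(D_{(c,i)}, D_{(d,j)})` is a valid descendant set pair for the (distinct)
character-state pairs `(c,i)` and `(d,j)`:
`f⁺_p(D_{(c,i)}) − f⁺_p(D_{(d,j)}) ≥ 0` for all samples `p`, and when `c = d`
additionally `D_{(d,j)} ⊊ D_{(c,i)}`. -/
def ValidPair (f : Fin m → Fin n → Fin k → ℝ) (c : Fin n) (i : Fin k)
    (d : Fin n) (j : Fin k) (Dci Ddj : Finset (Fin k)) : Prop :=
  (∀ p : Fin m, 0 ≤ fplus f p c Dci - fplus f p d Ddj) ∧ (c = d → Ddj ⊂ Dci)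

theorem CPPTree.anc_depth (T : CPPTree n k) {u v : PPVert n k} (h : T.anc u v) :
    u = v ∨ T.depth u < T.depth v := by
  induction h with
  | refl => exact Or.inl rfl
  | tail _ hbc ih =>
    obtain ⟨c, i, rfl, rfl⟩ := hbc
    have := T.depth_lt c i
    rcases ih with rfl | h
    · exact Or.inr this
    · exact Or.inr (h.trans this)

theorem CPPTree.anc_antisymm (T : CPPTree n k) {u v : PPVert n k} (h : T.anc u v)
    (h2 : T.anc v u) : u = v := by
  rcases T.anc_depth h with h | h
  · exact h
  · rcases T.anc_depth h2 with h' | h'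
    · exact h'.symm
    · omega

theorem CPPTree.anc_root (T : CPPTree n k) (v : PPVert n k) : T.anc none v := by
  induction hd : T.depth v using Nat.strong_induction_on generalizing v with
  | _ N ih =>
    rcases v with _ | ⟨c, i⟩
    · exact Relation.ReflTransGen.refl
    · exact (ih _ (hd ▸ T.depth_lt c i) _ rfl).tail ⟨c, i, rfl, rfl⟩

theorem vtx_zero (c : Fin n) : vtx c (0 : Fin k) = none := by simp [vtx]

theorem vtx_coe (c : Fin n) (i : {i : Fin k // i ≠ 0}) : vtx c i.1 = some (c, i) := by
  simp [vtx, i.2]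

theorem vtx_inj (c : Fin n) {i j : Fin k} (h : vtx c i = vtx c j) : i = j := by
  unfold vtx at h
  split_ifs at h with h1 h2 h2
  · rw [h1, h2]
  · simpa using h

/-- The cumulative frequency attached to a vertex. -/
noncomputable def vfreq (T : CPPTree n k) (f : Fin m → Fin n → Fin k → ℝ) (p : Fin m) :
    PPVert n k → ℝ
  | none => 1
  | some (c, i) => fplus f p c (T.D c i.1)

theorem vfreq_vtx (T : CPPTree n k) (f : Fin m → Fin n → Fin k → ℝ) (hf : IsFreqTensor f)
    (p : Fin m) (c : Fin n) (i : Fin k) :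
    vfreq T f p (vtx c i) = fplus f p c (T.D c i) := by
  by_cases h : i = 0
  · subst h
    have : T.D c 0 = univ := by
      ext j
      simp [CPPTree.D, vtx_zero, T.anc_root]
    rw [this, vtx_zero]
    exact (hf.2 p c).symm
  · rw [vtx_coe c ⟨i, h⟩]
    rfl

theorem usage_eq (T : CPPTree n k) (f : Fin m → Fin n → Fin k → ℝ) (p : Fin m)
    (v : PPVert n k) :
    usage T f p v = vfreq T f p v - ∑ dj ∈ T.childrenOf v, vfreq T f p (some dj) := by
  rcases v with _ | ⟨c, i⟩
  · rfl
  · simp only [usage, CPPTree.children, vtx_coe]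
    rfl

theorem vfreq_anti (T : CPPTree n k) (f : Fin m → Fin n → Fin k → ℝ) (hf : IsFreqTensor f)
    (hgen : Generates T f) (p : Fin m) {u v : PPVert n k} (h : T.anc u v) :
    vfreq T f p v ≤ vfreq T f p u := by
  induction h with
  | refl => exact le_rfl
  | @tail b _ _ hbc ih =>
    obtain ⟨c, i, rfl, hp⟩ := hbc
    refine le_trans ?_ ih
    have h0 := hgen.1 p b
    rw [usage_eq] at h0
    have h1 : vfreq T f p (some (c, i)) ≤ ∑ dj ∈ T.childrenOf b, vfreq T f p (some dj) :=
      Finset.single_le_sum (f := fun dj => vfreq T f p (some dj))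
        (fun dj _ => by
          show 0 ≤ ∑ l ∈ T.D dj.1 dj.2.1, f p dj.1 l
          exact Finset.sum_nonneg fun l _ => hf.1 p dj.1 l)
        (by simp [CPPTree.childrenOf, hp])
    linarith

/-- The strong form: the actual descendant sets of `T` form a valid pair. -/
theorem validPair_D (T : CPPTree n k) (f : Fin m → Fin n → Fin k → ℝ)
    (hf : IsFreqTensor f) (hgen : Generates T f)
    (c d : Fin n) (i j : Fin k)
    (hanc : T.anc (vtx c i) (vtx d j)) (hne : (c, i) ≠ (d, j)) :
    ValidPair f c i d j (T.D c i) (T.D d j) := by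
  refine ⟨fun p => ?_, ?_⟩
  · have := vfreq_anti T f hf hgen p hanc
    rw [vfreq_vtx T f hf, vfreq_vtx T f hf] at this
    linarith
  · rintro rfl
    rw [Finset.ssubset_iff_of_subset]
    · refine ⟨i, ?_, ?_⟩
      · simp only [CPPTree.D, mem_filter, mem_univ, true_and]
        exact Relation.ReflTransGen.refl
      · simp only [CPPTree.D, mem_filter, mem_univ, true_and]
        intro h
        exact hne (by rw [vtx_inj c (T.anc_antisymm hanc h)])
    · intro l
      simp only [CPPTree.D, mem_filter, mem_univ, true_and]
      exact fun h => Relation.ReflTransGen.trans hanc h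

/-- **Proposition 1.** Let `T` be an `n,k`-complete perfect
phylogeny tree that generates the frequency tensor `F`.  If `(c,i) ≺_T (d,j)`
with `(c,i) ≠ (d,j)`, then there exists a valid descendant set pair
`(D_{(c,i)}, D_{(d,j)})`. -/
theorem exists_validPair (T : CPPTree n k) (f : Fin m → Fin n → Fin k → ℝ)
    (hf : IsFreqTensor f) (hgen : Generates T f)
    (c d : Fin n) (i j : Fin k)
    (hanc : T.anc (vtx c i) (vtx d j)) (hne : (c, i) ≠ (d, j)) :
    ∃ Dci Ddj : Finset (Fin k), ValidPair f c i d j Dci Ddj := by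
  exact ⟨T.D c i, T.D d j, validPair_D T f hf hgen c d i j hanc hne⟩
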